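/- arXiv:2003.06624 — 3 statements merged into one kernel-verified Lean document; each statement's English description precedes it below -/
import Mathlib

section
/- Let G = ⟨g⟩ be a cyclic group of order 2p with p an odd prime, S ⊆ G with |S| = p, and X = BCay(G,S). If p divides the order of the stabilizer of the vertex (1,1) in Aut(X), then S = ⟨g²⟩ or S = ⟨g²⟩g, and in this case X is a BCI-graph. -/
open SimpleGraph

/-- The bi-Cayley graph `BCay(G,S)`: vertex set `G × {1,2}` (encoded as `G × Fin 2`,
where index `0` stands for part `1` and index `1` for part `2`), with edges
`{(g,1),(sg,2)}` for `g ∈ G`, `s ∈ S`. -/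
def BCay (G : Type*) [Group G] (S : Set G) : SimpleGraph (G × Fin 2) :=
  SimpleGraph.fromRel (fun u v => u.2 = 0 ∧ v.2 = 1 ∧ v.1 * u.1⁻¹ ∈ S)

/-- `BCay(G,S)` is a BCI-graph. -/
def IsBCIGraph (G : Type*) [Group G] (S : Set G) : Prop :=
  ∀ T : Set G, Nonempty (BCay G S ≃g BCay G T) →
    ∃ (g : G) (α : G ≃* G), T = (fun s => g * α s) '' S

/-- `G` is a BCI-group. -/
def IsBCIGroup (G : Type*) [Group G] : Prop :=
  ∀ S : Set G, IsBCIGraph G S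

/-- `G` is an `m`-BCI-group. -/
def IsmBCIGroup (G : Type*) [Group G] (m : ℕ) : Prop :=
  ∀ S : Set G, S.ncard ≤ m → IsBCIGraph G S

/-- The Cayley graph `Cay(G,S)`, for `1 ∉ S = S⁻¹`. -/
def Cay (G : Type*) [Group G] (S : Set G) : SimpleGraph G :=
  SimpleGraph.fromRel (fun x y => y * x⁻¹ ∈ S)

/-- `Cay(G,S)` is a CI-graph. -/
def IsCIGraph (G : Type*) [Group G] (S : Set G) : Prop :=
  ∀ T : Set G, 1 ∉ T → T⁻¹ = T → Nonempty (Cay G S ≃g Cay G T) →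
    ∃ α : G ≃* G, T = α '' S

/-- `G` is a CI-group. -/
def IsCIGroup (G : Type*) [Group G] : Prop :=
  ∀ S : Set G, 1 ∉ S → S⁻¹ = S → IsCIGraph G S

/-- `G` is an `m`-CI-group. -/
def IsmCIGroup (G : Type*) [Group G] (m : ℕ) : Prop :=
  ∀ S : Set G, 1 ∉ S → S⁻¹ = S → S.ncard ≤ m → IsCIGraph G S

section BCayAdjacency

variable {G : Type*} [Group G] {S : Set G}

theorem BCay_adj_zero_one (x y : G) : (BCay G S).Adj (x, 0) (y, 1) ↔ y * x⁻¹ ∈ S := by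
  simp [BCay]

theorem BCay_adj_one_zero (x y : G) : (BCay G S).Adj (y, 1) (x, 0) ↔ y * x⁻¹ ∈ S := by
  rw [SimpleGraph.adj_comm, BCay_adj_zero_one]

theorem BCay_snd_ne_of_adj {u v : G × Fin 2} (h : (BCay G S).Adj u v) : u.2 ≠ v.2 := by
  rcases h with ⟨-, ⟨h, h', -⟩ | ⟨h, h', -⟩⟩ <;> simp [h, h']

theorem BCay_neighborSet_zero (x : G) :
    (BCay G S).neighborSet (x, 0) = (fun s => (s * x, (1 : Fin 2))) '' S := by
  ext ⟨y, j⟩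
  rw [SimpleGraph.mem_neighborSet]
  constructor
  · intro h
    have hj : j = 1 := by
      have := BCay_snd_ne_of_adj h
      simp only at this
      omega
    subst hj
    exact ⟨y * x⁻¹, (BCay_adj_zero_one x y).1 h, by simp⟩
  · rintro ⟨s, hs, h⟩
    obtain ⟨rfl, rfl⟩ := Prod.mk.inj h
    rw [BCay_adj_zero_one]
    simpa using hs

theorem BCay_neighborSet_one (y : G) :
    (BCay G S).neighborSet (y, 1) = (fun s => (s⁻¹ * y, (0 : Fin 2))) '' S := by
  ext ⟨x, j⟩
  rw [SimpleGraph.mem_neighborSet]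
  constructor
  · intro h
    have hj : j = 0 := by
      have := BCay_snd_ne_of_adj h
      simp only at this
      omega
    subst hj
    exact ⟨y * x⁻¹, (BCay_adj_one_zero x y).1 h, by simp⟩
  · rintro ⟨s, hs, h⟩
    obtain ⟨rfl, rfl⟩ := Prod.mk.inj h
    rw [BCay_adj_one_zero]
    simpa using hs

theorem BCay_ncard_neighborSet (v : G × Fin 2) :
    ((BCay G S).neighborSet v).ncard = S.ncard := by
  obtain ⟨x, i⟩ := v
  fin_cases i
  · exact (congrArg Set.ncard (BCay_neighborSet_zero x)).trans
      (Set.ncard_image_of_injective _ fun a b h => by simpa using h)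
  · exact (congrArg Set.ncard (BCay_neighborSet_one x)).trans
      (Set.ncard_image_of_injective _ fun a b h => by simpa using h)

/-- In an abelian group, two vertices of `BCay G S` with the same neighbours yield a nontrivial
translation preserving `S`. -/
theorem exists_translation_of_neighborSet_eq (hcomm : ∀ a b : G, a * b = b * a)
    (hne : S.Nonempty) {u v : G × Fin 2} (huv : u ≠ v)
    (h : (BCay G S).neighborSet u = (BCay G S).neighborSet v) :
    ∃ x : G, x ≠ 1 ∧ ∀ y, x * y ∈ S ↔ y ∈ S := by
  obtain ⟨s, hs⟩ := hne
  obtain ⟨a, i⟩ := u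
  obtain ⟨b, j⟩ := v
  have key : ∀ w, (BCay G S).Adj (a, i) w ↔ (BCay G S).Adj (b, j) w := fun w => by
    simp only [← SimpleGraph.mem_neighborSet, h]
  have hij : i = j := by
    have hw : ∃ w, (BCay G S).Adj (a, i) w := by
      fin_cases i
      · exact ⟨(s * a, 1), (BCay_adj_zero_one _ _).2 (by simpa using hs)⟩
      · exact ⟨(s⁻¹ * a, 0), (BCay_adj_one_zero _ _).2 (by simpa using hs)⟩
    obtain ⟨w, hw⟩ := hw
    have h₁ := BCay_snd_ne_of_adj hw
    have h₂ := BCay_snd_ne_of_adj ((key w).1 hw)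
    simp only at h₁ h₂
    omega
  subst hij
  have hab : a ≠ b := fun h => huv (by rw [h])
  fin_cases i
  · refine ⟨b * a⁻¹, fun h => hab (mul_inv_eq_one.1 h).symm, fun y => ?_⟩
    have := key (y * b, 1)
    simp only [Fin.zero_eta, BCay_adj_zero_one] at this
    rw [mul_inv_cancel_right] at this
    rw [← this, mul_assoc y, hcomm]
  · refine ⟨a * b⁻¹, fun h => hab (mul_inv_eq_one.1 h), fun y => ?_⟩
    have := key (y⁻¹ * b, 0)
    simp only [Fin.mk_one, BCay_adj_one_zero] at this
    rw [mul_inv_rev, inv_inv, mul_inv_cancel_left] at this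
    rw [← this, mul_assoc]

end BCayAdjacency

section CyclicTwoP

open scoped Pointwise

variable {G : Type*} [Group G] {p : ℕ} {g : G}

theorem mul_comm_of_forall_mem_zpowers (hgen : ∀ x : G, x ∈ Subgroup.zpowers g) (a b : G) :
    a * b = b * a := by
  obtain ⟨m, rfl⟩ := hgen a
  obtain ⟨n, rfl⟩ := hgen b
  exact zpow_mul_comm g m n

theorem mem_zpowers_sq_iff_pow_eq_one (hp : p.Prime) (hgen : ∀ x : G, x ∈ Subgroup.zpowers g)
    (hcard : Nat.card G = 2 * p) (x : G) : x ∈ Subgroup.zpowers (g ^ 2) ↔ x ^ p = 1 := by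
  have hord : orderOf g = 2 * p := by rw [← hcard]; exact orderOf_eq_card_of_forall_mem_zpowers hgen
  constructor
  · rintro ⟨k, rfl⟩
    have : (g ^ 2) ^ p = 1 := by rw [← pow_mul, ← hord, pow_orderOf_eq_one]
    simp only
    rw [← zpow_natCast, ← zpow_mul, mul_comm, zpow_mul, zpow_natCast, this, one_zpow]
  · intro hx
    obtain ⟨k, rfl⟩ := hgen x
    simp only at hx
    rw [← zpow_natCast, ← zpow_mul, ← orderOf_dvd_iff_zpow_eq_one, hord] at hx
    push_cast at hx
    have hp0 : (p : ℤ) ≠ 0 := by exact_mod_cast hp.ne_zero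
    obtain ⟨m, rfl⟩ := Int.dvd_of_mul_dvd_mul_right hp0 hx
    exact ⟨m, by simp [zpow_mul, pow_two]⟩

/-- A `p`-subset of a cyclic group of order `2p` that is preserved by a nontrivial translation is a
coset of the subgroup of order `p`. -/
theorem eq_coset_of_translation [Finite G] (hp : p.Prime) (hgen : ∀ x : G, x ∈ Subgroup.zpowers g)
    (hcard : Nat.card G = 2 * p) {T : Set G} (hT : T.ncard = p) {x : G} (hx : x ≠ 1)
    (hxT : ∀ y, x * y ∈ T ↔ y ∈ T) :
    ∃ t, ∀ y, y ∈ T ↔ y * t⁻¹ ∈ Subgroup.zpowers (g ^ 2) := by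
  obtain ⟨t, ht⟩ : T.Nonempty := by
    rw [← Set.ncard_pos, hT]; exact hp.pos
  set K := MulAction.stabilizer G T with hK
  have hxK : x ∈ K := by
    rw [hK, MulAction.mem_stabilizer_set]
    exact hxT
  have hdvd : Nat.card K ∣ p := by
    have hpre : (QuotientGroup.mk : G → G ⧸ K) ⁻¹' (QuotientGroup.mk '' T) = T := by
      refine Set.Subset.antisymm ?_ (Set.subset_preimage_image _ _)
      rintro y ⟨z, hz, hzy⟩
      have := (MulAction.mem_stabilizer_set.1 (QuotientGroup.eq.1 hzy) z).2 hz
      rwa [smul_eq_mul, mul_comm_of_forall_mem_zpowers hgen, mul_inv_cancel_left] at this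
    have h := QuotientGroup.card_preimage_mk K (QuotientGroup.mk '' T)
    rw [hpre] at h
    exact ⟨_, hT.symm.trans h⟩
  have hKp : Nat.card K = p := by
    rcases (Nat.dvd_prime hp).1 hdvd with h | h
    · rw [Subgroup.card_eq_one] at h
      rw [h, Subgroup.mem_bot] at hxK
      exact absurd hxK hx
    · exact h
  have hsub : (fun k => k * t) '' (K : Set G) ⊆ T := by
    rintro _ ⟨k, hk, rfl⟩
    exact (MulAction.mem_stabilizer_set.1 hk t).2 ht
  have hcardK : ((fun k => k * t) '' (K : Set G)).ncard = p := by
    rw [Set.ncard_image_of_injective _ (mul_left_injective t), ← hKp]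
    rfl
  have hTeq := Set.eq_of_subset_of_ncard_le hsub (by rw [hcardK, hT])
  have hKH : ∀ y, y ∈ K ↔ y ∈ Subgroup.zpowers (g ^ 2) := by
    have hle : K ≤ Subgroup.zpowers (g ^ 2) := fun y hy => by
      rw [mem_zpowers_sq_iff_pow_eq_one hp hgen hcard, ← hKp]
      exact congrArg Subtype.val (pow_card_eq_one' (x := (⟨y, hy⟩ : K)))
    have hHp : Nat.card (Subgroup.zpowers (g ^ 2)) = p := by
      have hord : orderOf g = 2 * p := by
        rw [← hcard]; exact orderOf_eq_card_of_forall_mem_zpowers hgen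
      rw [Nat.card_zpowers, orderOf_pow_of_dvd two_ne_zero (by simp [hord]), hord]
      simp
    have := Subgroup.eq_of_le_of_card_ge hle (by rw [hHp, hKp])
    intro y; rw [this]
  refine ⟨t, fun y => ?_⟩
  rw [← hKH, ← hTeq]
  constructor
  · rintro ⟨k, hk, rfl⟩
    simpa using hk
  · intro h
    exact ⟨_, h, by simp⟩

end CyclicTwoP

/-- If `α` and `β` preserve a `p`-regular relation on sets of size `2p`, where `β` is nontrivial of
order `p` and `α` fixes at least three points, then two points are related to the same set. -/
theorem exists_related_sets_eq {V W : Type*} [Finite W] {p : ℕ} (hp : p.Prime)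
    (hcard : Nat.card W = 2 * p) (R : V → W → Prop) (hR : ∀ x, {y | R x y}.ncard = p)
    (α : V → V) (β : W → W) (hαβ : ∀ x y, R (α x) (β y) ↔ R x y)
    (hβ : ∀ y, β^[p] y = y) {w : W} (hw : β w ≠ w) (hα : 2 < (Function.fixedPoints α).ncard) :
    ∃ x x', x ≠ x' ∧ {y | R x y} = {y | R x' y} := by
  have hper : Function.minimalPeriod β w = p := by
    rcases (Nat.dvd_prime hp).1 (Function.IsPeriodicPt.minimalPeriod_dvd (hβ w)) with h | h
    · exact absurd (Function.minimalPeriod_eq_one_iff_isFixedPt.1 h) hw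
    · exact h
  set A : Set W := (fun k => β^[k] w) '' (Finset.range p : Set ℕ) with hA
  have hAcard : A.ncard = p := by
    rw [hA, Set.InjOn.ncard_image, Set.ncard_coe_finset, Finset.card_range]
    intro a ha b hb hab
    simp only [Finset.coe_range, Set.mem_Iio] at ha hb
    exact (Function.iterate_eq_iterate_iff_of_lt_minimalPeriod (by rwa [hper]) (by rwa [hper])).1 hab
  have hN : ∀ x ∈ Function.fixedPoints α, {y | R x y} = A ∨ {y | R x y} = Aᶜ := by
    intro x hx
    have hinv : ∀ k y, R x (β^[k] y) ↔ R x y := by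
      intro k
      induction k with
      | zero => simp
      | succ k ih =>
        intro y
        rw [Function.iterate_succ_apply, ih]
        have := hαβ x y
        rwa [show α x = x from hx] at this
    by_cases h : R x w
    · left
      symm
      refine Set.eq_of_subset_of_ncard_le ?_ (by rw [hR, hAcard])
      rintro _ ⟨k, -, rfl⟩
      exact (hinv k w).2 h
    · right
      refine Set.eq_of_subset_of_ncard_le ?_ ?_
      · rintro y hy ⟨k, -, rfl⟩
        exact h ((hinv k w).1 hy)
      · rw [Set.ncard_compl, hR, hAcard, hcard]
        omega
  have hfin : (Function.fixedPoints α).Finite := Set.finite_of_ncard_pos (by omega)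
  obtain ⟨a, b, c, ha, hb, hc, hab, hac, hbc⟩ := (Set.two_lt_ncard_iff hfin).1 hα
  rcases hN a ha with h1 | h1 <;> rcases hN b hb with h2 | h2 <;> rcases hN c hc with h3 | h3 <;>
  first
  | exact ⟨a, b, hab, h1.trans h2.symm⟩
  | exact ⟨a, c, hac, h1.trans h3.symm⟩
  | exact ⟨b, c, hbc, h2.trans h3.symm⟩

theorem two_lt_ncard_fixedPoints {V : Type*} [Finite V] {p : ℕ} (hp : p.Prime) (hodd : Odd p)
    {α : V → V} (hα : ∀ x, α^[p] x = x) (hcard : Nat.card V = 2 * p)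
    {v : V} (hv : α v = v) : 2 < (Function.fixedPoints α).ncard := by
  classical
  have := Fact.mk hp
  have := Fintype.ofFinite V
  have h := Equiv.Perm.card_fixedPoints_modEq (f := (α : Function.End V)) (p := p) (n := 1)
    (by
      funext x
      rw [pow_one]
      exact (congrFun (hom_coe_pow (fun f : Function.End V => (f : V → V)) rfl
        (fun _ _ => rfl) α p) x).trans (hα x))
  rw [← Nat.card_eq_fintype_card, ← Nat.card_eq_fintype_card, hcard] at h
  have h2 : p ∣ (Function.fixedPoints α).ncard := by
    have : 0 ≡ (Function.fixedPoints α).ncard [MOD p] :=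
      ((Nat.modEq_zero_iff_dvd.2 (Dvd.intro_left 2 rfl)).symm).trans h
    exact Nat.modEq_zero_iff_dvd.1 this.symm
  have hpos : 0 < (Function.fixedPoints α).ncard := (Set.ncard_pos (Set.toFinite _)).2 ⟨v, hv⟩
  have := Nat.le_of_dvd hpos h2
  have := hp.two_le
  obtain ⟨k, rfl⟩ := hodd
  omega

/-- If the quotients `t⁻¹ * s` with `s, t ∈ S` generate `G`, every automorphism of `BCay G S`
that fixes `(1, 0)` preserves both parts. -/
theorem BCay_snd_apply_of_closure_eq_top {G : Type*} [Group G] {S : Set G} (hne : S.Nonempty)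
    (hD : Subgroup.closure {x : G | ∃ s ∈ S, ∃ t ∈ S, x = t⁻¹ * s} = ⊤)
    (σ : BCay G S ≃g BCay G S) (hσ : σ ((1 : G), (0 : Fin 2)) = ((1 : G), (0 : Fin 2)))
    (v : G × Fin 2) : (σ v).2 = v.2 := by
  have step : ∀ {u v : G × Fin 2}, (BCay G S).Adj u v → ((σ u).2 = u.2 ↔ (σ v).2 = v.2) := by
    intro u v h
    have h₁ := BCay_snd_ne_of_adj h
    have h₂ := BCay_snd_ne_of_adj (σ.map_adj_iff.2 h)
    omega
  have h0 : ∀ y x : G, (σ (y * x, 0)).2 = 0 ↔ (σ (x, 0)).2 = 0 := by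
    intro y
    have hy : y ∈ Subgroup.closure {x : G | ∃ s ∈ S, ∃ t ∈ S, x = t⁻¹ * s} := by
      rw [hD]; trivial
    induction hy using Subgroup.closure_induction with
    | mem y hy =>
      obtain ⟨s, hs, t, ht, rfl⟩ := hy
      intro x
      have h₁ := step ((BCay_adj_zero_one (S := S) x (s * x)).2 (by simpa using hs))
      have h₂ := step ((BCay_adj_zero_one (S := S) (t⁻¹ * s * x) (s * x)).2
        (by simpa [mul_assoc] using ht))
      exact h₂.trans h₁.symm
    | one => simp
    | mul a b _ _ iha ihb => intro x; rw [mul_assoc, iha, ihb]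
    | inv a _ ih => intro x; rw [← ih, mul_inv_cancel_left]
  have h0' : ∀ x : G, (σ (x, 0)).2 = 0 := fun x => by
    have := (h0 x 1).2 (by rw [hσ])
    rwa [mul_one] at this
  obtain ⟨x, i⟩ := v
  obtain ⟨s, hs⟩ := hne
  fin_cases i
  · exact h0' x
  · exact (step ((BCay_adj_zero_one (S := S) (s⁻¹ * x) x).2 (by simpa using hs))).1 (h0' _)

theorem exists_translation_of_dvd_card_stabilizer {G : Type*} [Group G] [Finite G] {p : ℕ}
    (hcomm : ∀ a b : G, a * b = b * a) (hp : p.Prime) (hodd : Odd p)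
    (hcard : Nat.card G = 2 * p) {S : Set G} (hS : S.ncard = p)
    (hdvd : p ∣ Nat.card {σ : BCay G S ≃g BCay G S //
        σ ((1 : G), (0 : Fin 2)) = ((1 : G), (0 : Fin 2))}) :
    ∃ x : G, x ≠ 1 ∧ ∀ y, x * y ∈ S ↔ y ∈ S := by
  have hne : S.Nonempty := by rw [← Set.ncard_pos, hS]; exact hp.pos
  by_cases hD : Subgroup.closure {x : G | ∃ s ∈ S, ∃ t ∈ S, x = t⁻¹ * s} = ⊤
  swap
  · obtain ⟨s₀, hs₀⟩ := hne
    set D := Subgroup.closure {x : G | ∃ s ∈ S, ∃ t ∈ S, x = t⁻¹ * s} with hDdef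
    have hsub : S ⊆ (fun d => s₀ * d) '' (D : Set G) := fun s hs =>
      ⟨s₀⁻¹ * s, Subgroup.subset_closure ⟨s, hs, s₀, hs₀, rfl⟩, by simp⟩
    have hDc : ((fun d => s₀ * d) '' (D : Set G)).ncard = Nat.card D := by
      rw [Set.ncard_image_of_injective _ (mul_right_injective s₀)]; rfl
    have hle : Nat.card D ≤ p := by
      have h1 := D.card_mul_index
      have h2 : D.index ≠ 1 := fun h => hD (Subgroup.index_eq_one.1 h)
      have h3 : D.index ≠ 0 := Subgroup.index_ne_zero_of_finite
      rw [hcard] at h1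
      have : 2 ≤ D.index := by omega
      nlinarith
    have heq := Set.eq_of_subset_of_ncard_le hsub (by rw [hDc, hS]; exact hle)
    have hDp : Nat.card D = p := by rw [← hDc, ← heq, hS]
    obtain ⟨x, hx⟩ : ∃ x : D, x ≠ 1 := by
      have : Nontrivial D := Finite.one_lt_card_iff_nontrivial.1 (by rw [hDp]; exact hp.one_lt)
      exact exists_ne 1
    refine ⟨x, by simpa using hx, fun y => ?_⟩
    have hmem : ∀ z, z ∈ S ↔ s₀⁻¹ * z ∈ D := fun z => by
      rw [heq]
      constructor
      · rintro ⟨d, hd, rfl⟩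
        simpa using hd
      · exact fun h => ⟨_, h, by simp⟩
    rw [hmem, hmem, ← mul_assoc, hcomm s₀⁻¹, mul_assoc, D.mul_mem_cancel_left x.2]
  let K : Subgroup (BCay G S ≃g BCay G S) :=
    { carrier := {σ | σ ((1 : G), (0 : Fin 2)) = ((1 : G), (0 : Fin 2))}
      one_mem' := rfl
      mul_mem' := fun {a b} ha hb => by
        change a (b _) = _
        rw [show b _ = _ from hb]; exact ha
      inv_mem' := fun {a} ha => (RelIso.symm_apply_eq a).2 (Eq.symm ha) }
  have := Fact.mk hp
  have : Finite (BCay G S ≃g BCay G S) := DFunLike.finite _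
  obtain ⟨⟨σ, hσ⟩, hord⟩ := exists_prime_orderOf_dvd_card' (G := K) p hdvd
  rw [Subgroup.orderOf_mk] at hord
  have hpart := BCay_snd_apply_of_closure_eq_top hne hD σ hσ
  have hpow : ∀ v, σ^[p] v = v := by
    have h : ∀ n v, (σ ^ n) v = σ^[n] v := by
      intro n
      induction n with
      | zero => intro v; rfl
      | succ n ih =>
        intro v
        rw [pow_succ, Function.iterate_succ_apply, ← ih]; rfl
    intro v
    rw [← h, ← hord, pow_orderOf_eq_one]; rfl
  let act : Fin 2 → G → G := fun i x => (σ (x, i)).1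
  have hact : ∀ i x, σ (x, i) = (act i x, i) := fun i x => Prod.ext rfl (hpart _)
  have hactp : ∀ i x, (act i)^[p] x = x := by
    intro i x
    have h : ∀ n x, σ^[n] (x, i) = ((act i)^[n] x, i) := by
      intro n
      induction n with
      | zero => intro x; rfl
      | succ n ih => intro x; rw [Function.iterate_succ_apply, hact, ih]; rfl
    exact congrArg Prod.fst ((h p x).symm.trans (hpow _))
  have hadj : ∀ x y, act 1 y * (act 0 x)⁻¹ ∈ S ↔ y * x⁻¹ ∈ S := by
    intro x y
    rw [← BCay_adj_zero_one, ← BCay_adj_zero_one, ← hact, ← hact, σ.map_adj_iff]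
  have hinj : ∀ i : Fin 2, Function.Injective fun z : G => (z, i) := fun i a b h =>
    congrArg Prod.fst h
  by_cases h1 : ∀ y, act 1 y = y
  · obtain ⟨w, hw⟩ : ∃ w, act 0 w ≠ w := by
      by_contra! h0
      have : σ = 1 := by
        ext1 ⟨x, i⟩
        rw [hact]
        fin_cases i
        · exact Prod.ext (h0 x) rfl
        · exact Prod.ext (h1 x) rfl
      rw [this, orderOf_one] at hord
      exact hp.one_lt.ne hord
    have hset : ∀ y, (fun z : G => (z, (0 : Fin 2))) '' {x | y * x⁻¹ ∈ S} =
        (BCay G S).neighborSet (y, 1) := by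
      intro y
      rw [BCay_neighborSet_one]
      ext v
      constructor
      · rintro ⟨x, hx, rfl⟩
        exact ⟨_, hx, by simp⟩
      · rintro ⟨s, hs, rfl⟩
        exact ⟨_, by simpa using hs, rfl⟩
    obtain ⟨a, b, hab, h⟩ := exists_related_sets_eq hp hcard (fun y x : G => y * x⁻¹ ∈ S)
      (fun y => by
        rw [← Set.ncard_image_of_injective _ (hinj 0), hset, BCay_ncard_neighborSet, hS])
      (act 1) (act 0) (fun y x => hadj x y) (hactp 0) hw
      (two_lt_ncard_fixedPoints hp hodd (hactp 1) hcard (h1 1))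
    refine exists_translation_of_neighborSet_eq hcomm hne (u := (a, 1)) (v := (b, 1))
      (fun h => hab (hinj 1 h)) ?_
    rw [← hset, ← hset, h]
  · push Not at h1
    obtain ⟨w, hw⟩ := h1
    have hset : ∀ x, (fun z : G => (z, (1 : Fin 2))) '' {y | y * x⁻¹ ∈ S} =
        (BCay G S).neighborSet (x, 0) := by
      intro x
      rw [BCay_neighborSet_zero]
      ext v
      constructor
      · rintro ⟨y, hy, rfl⟩
        exact ⟨_, hy, by simp⟩
      · rintro ⟨s, hs, rfl⟩
        exact ⟨_, by simpa using hs, rfl⟩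
    obtain ⟨a, b, hab, h⟩ := exists_related_sets_eq hp hcard (fun x y : G => y * x⁻¹ ∈ S)
      (fun x => by
        rw [← Set.ncard_image_of_injective _ (hinj 1), hset, BCay_ncard_neighborSet, hS])
      (act 0) (act 1) hadj (hactp 1) hw
      (two_lt_ncard_fixedPoints hp hodd (hactp 0) hcard (v := 1) (congrArg Prod.fst hσ))
    refine exists_translation_of_neighborSet_eq hcomm hne (u := (a, 0)) (v := (b, 0))
      (fun h => hab (hinj 0 h)) ?_
    rw [← hset, ← hset, h]

/-- For `G = ⟨g⟩` cyclic of order `2p` (`p` an odd prime) and `|S| = p`: if `p` divides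
the order of the stabilizer of `(1,1)` in `Aut(BCay(G,S))`, then `S = ⟨g²⟩` or
`S = ⟨g²⟩g`, and `BCay(G,S)` is a BCI-graph. -/
theorem stabilizer_dvd_cyclic_2p (G : Type*) [Group G] [Finite G]
    (p : ℕ) (hp : p.Prime) (hodd : Odd p)
    (g : G) (hgen : ∀ x : G, x ∈ Subgroup.zpowers g) (hcard : Nat.card G = 2 * p)
    (S : Set G) (hS : S.ncard = p)
    (hdvd : p ∣ Nat.card {σ : BCay G S ≃g BCay G S //
        σ ((1 : G), (0 : Fin 2)) = ((1 : G), (0 : Fin 2))}) :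
    (S = (Subgroup.zpowers (g ^ 2) : Set G) ∨
      S = (· * g) '' (Subgroup.zpowers (g ^ 2) : Set G)) ∧
    IsBCIGraph G S := by
  have hcomm := mul_comm_of_forall_mem_zpowers hgen
  obtain ⟨x, hx, hxS⟩ := exists_translation_of_dvd_card_stabilizer hcomm hp hodd hcard hS hdvd
  obtain ⟨t, ht⟩ := eq_coset_of_translation hp hgen hcard hS hx hxS
  refine ⟨?_, ?_⟩
  · obtain ⟨k, rfl⟩ := hgen t
    rcases Int.even_or_odd' k with ⟨m, rfl | rfl⟩
    · left
      ext y
      have hm : (g ^ (2 * m))⁻¹ ∈ Subgroup.zpowers (g ^ 2) :=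
        inv_mem ⟨m, by simp [zpow_mul, pow_two]⟩
      exact (ht y).trans (Subgroup.mul_mem_cancel_right _ hm)
    · right
      ext y
      have hm : (g ^ (2 * m))⁻¹ ∈ Subgroup.zpowers (g ^ 2) :=
        inv_mem ⟨m, by simp [zpow_mul, pow_two]⟩
      have hy : y ∈ S ↔ y * g⁻¹ ∈ Subgroup.zpowers (g ^ 2) := by
        rw [ht]
        simp only
        rw [zpow_add, zpow_one, mul_inv_rev, ← mul_assoc, Subgroup.mul_mem_cancel_right _ hm]
      rw [hy]
      constructor
      · exact fun h => ⟨_, h, by simp⟩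
      · rintro ⟨z, hz, rfl⟩
        simpa using hz
  · rintro T ⟨φ⟩
    have himage : ∀ v, (BCay G T).neighborSet (φ v) = φ '' (BCay G S).neighborSet v := by
      intro v
      ext w
      obtain ⟨w, rfl⟩ := φ.surjective w
      rw [SimpleGraph.mem_neighborSet, φ.map_adj_iff, φ.injective.mem_set_image,
        SimpleGraph.mem_neighborSet]
    have hT : T.ncard = p := by
      rw [← BCay_ncard_neighborSet (φ (1, 0)), himage, Set.ncard_image_of_injective _ φ.injective,
        BCay_ncard_neighborSet, hS]
    have hneT : T.Nonempty := by rw [← Set.ncard_pos, hT]; exact hp.pos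
    have htwin : (BCay G S).neighborSet (x, 0) = (BCay G S).neighborSet (1, 0) := by
      rw [BCay_neighborSet_zero, BCay_neighborSet_zero]
      ext v
      constructor
      · rintro ⟨s, hs, rfl⟩
        exact ⟨x * s, (hxS s).2 hs, by simp [hcomm x s]⟩
      · rintro ⟨s, hs, rfl⟩
        refine ⟨x⁻¹ * s, (hxS _).1 (by simpa using hs), ?_⟩
        rw [hcomm x⁻¹ s]
        simp
    obtain ⟨z, hz, hzT⟩ := exists_translation_of_neighborSet_eq hcomm hneT
      (u := φ (x, 0)) (v := φ (1, 0)) (fun h => hx (congrArg Prod.fst (φ.injective h)))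
      (by rw [himage, himage, htwin])
    obtain ⟨t', ht'⟩ := eq_coset_of_translation hp hgen hcard hT hz hzT
    refine ⟨t' * t⁻¹, MulEquiv.refl G, ?_⟩
    ext y
    constructor
    · intro hy
      refine ⟨t * t'⁻¹ * y, ?_, by simp [mul_assoc]⟩
      rw [ht, hcomm, mul_assoc t, inv_mul_cancel_left, hcomm]
      exact (ht' y).1 hy
    · rintro ⟨s, hs, rfl⟩
      rw [ht']
      simp only [MulEquiv.refl_apply]
      rw [hcomm, mul_assoc t', inv_mul_cancel_left, hcomm]
      exact (ht s).1 hs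
end

section
/- The dihedral group D₁₀ of order 10 is a 4-BCI-group: every bi-Cayley graph BCay(D₁₀, S) with |S| ≤ 4 is a BCI-graph. -/
open SimpleGraph

open scoped Pointwise

/-- Two subsets of a group are affinely equivalent if one is the image of the other under an
automorphism followed by a left translation. -/
def AffEquiv {G : Type*} [Group G] (S T : Set G) : Prop :=
  ∃ (g : G) (α : G ≃* G), T = (fun s => g * α s) '' S

section AffEquiv

variable {G : Type*} [Group G]

theorem AffEquiv.symm {S T : Set G} (h : AffEquiv S T) : AffEquiv T S := by
  obtain ⟨g, α, rfl⟩ := h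
  exact ⟨α.symm g⁻¹, α.symm, by simp [Set.image_image]⟩

theorem AffEquiv.trans {S T U : Set G} (h : AffEquiv S T) (h' : AffEquiv T U) :
    AffEquiv S U := by
  obtain ⟨g, α, rfl⟩ := h
  obtain ⟨k, β, rfl⟩ := h'
  exact ⟨k * β g, α.trans β, by simp [Set.image_image, mul_assoc]⟩

theorem ncard_singleton_mul (g : G) (X : Set G) : ({g} * X).ncard = X.ncard := by
  rw [Set.singleton_mul]
  exact Set.ncard_image_of_injective _ (mul_right_injective g)

theorem ncard_mul_singleton (g : G) (X : Set G) : (X * {g}).ncard = X.ncard := by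
  rw [Set.mul_singleton]
  exact Set.ncard_image_of_injective _ (mul_left_injective g)

theorem ncard_inv_set (X : Set G) : X⁻¹.ncard = X.ncard := by
  rw [← Set.image_inv_eq_inv]
  exact Set.ncard_image_of_injective _ inv_injective

theorem affine_image_eq (g : G) (α : G ≃* G) (S : Set G) :
    (fun s => g * α s) '' S = {g} * α '' S := by
  rw [Set.singleton_mul, Set.image_image]

theorem AffEquiv.ncard_eq {S T : Set G} (h : AffEquiv S T) : S.ncard = T.ncard := by
  obtain ⟨g, α, rfl⟩ := h
  rw [affine_image_eq, ncard_singleton_mul, Set.ncard_image_of_injective _ α.injective]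

theorem AffEquiv.ncard_inv_mul {S T : Set G} (h : AffEquiv S T) :
    (S⁻¹ * S).ncard = (T⁻¹ * T).ncard := by
  obtain ⟨g, α, rfl⟩ := h
  have : ({g} * α '' S)⁻¹ * ({g} * α '' S) = α '' (S⁻¹ * S) := by
    rw [Set.image_mul, Set.image_inv, mul_inv_rev, mul_assoc, ← mul_assoc _ {g} (α '' S)]
    simp
  rw [affine_image_eq, this, Set.ncard_image_of_injective _ α.injective]

theorem AffEquiv.ncard_mul_inv {S T : Set G} (h : AffEquiv S T) :
    (S * S⁻¹).ncard = (T * T⁻¹).ncard := by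
  obtain ⟨g, α, rfl⟩ := h
  have : ({g} * α '' S) * ({g} * α '' S)⁻¹ = {g} * α '' (S * S⁻¹) * {g⁻¹} := by
    rw [Set.image_mul, Set.image_inv, mul_inv_rev, Set.inv_singleton]
    simp only [mul_assoc]
  rw [affine_image_eq, this, ncard_mul_singleton, ncard_singleton_mul,
    Set.ncard_image_of_injective _ α.injective]

theorem AffEquiv.ncard_mul_inv_mul {S T : Set G} (h : AffEquiv S T) :
    (S * (S⁻¹ * S)).ncard = (T * (T⁻¹ * T)).ncard := by
  obtain ⟨g, α, rfl⟩ := h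
  have : ({g} * α '' S) * (({g} * α '' S)⁻¹ * ({g} * α '' S)) =
      {g} * α '' (S * (S⁻¹ * S)) := by
    rw [Set.image_mul, Set.image_mul, Set.image_inv, mul_inv_rev, mul_assoc, mul_assoc,
      ← mul_assoc _ {g} (α '' S)]
    simp
  rw [affine_image_eq, this, ncard_singleton_mul, Set.ncard_image_of_injective _ α.injective]

end AffEquiv

section Neighbors

/-- The set of vertices adjacent to some vertex of `X`. -/
def SimpleGraph.neighborsOf {V : Type*} (H : SimpleGraph V) (X : Set V) : Set V :=
  {w | ∃ v ∈ X, H.Adj v w}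

theorem SimpleGraph.Iso.image_neighborsOf {V W : Type*} {H : SimpleGraph V} {K : SimpleGraph W}
    (φ : H ≃g K) (X : Set V) : φ '' H.neighborsOf X = K.neighborsOf (φ '' X) := by
  ext w
  obtain ⟨w, rfl⟩ := φ.surjective w
  simp [SimpleGraph.neighborsOf, φ.map_adj_iff, φ.injective.eq_iff]

variable {G : Type*} [Group G]

theorem neighborsOf_BCay_zero (S X : Set G) :
    (BCay G S).neighborsOf (X ×ˢ {0}) = (S * X) ×ˢ {1} := by
  ext ⟨h, j⟩
  simp only [SimpleGraph.neighborsOf, BCay, SimpleGraph.fromRel_adj, Set.mem_ofPred_eq,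
    Set.mem_prod, Set.mem_singleton_iff, Set.mem_mul]
  constructor
  · rintro ⟨⟨x, i⟩, ⟨hx, rfl⟩, -, ⟨-, rfl, hs⟩ | ⟨-, h0, -⟩⟩
    · exact ⟨⟨_, hs, x, hx, by simp⟩, rfl⟩
    · simp at h0
  · rintro ⟨⟨s, hs, x, hx, rfl⟩, rfl⟩
    exact ⟨(x, 0), ⟨hx, rfl⟩, by simp, by simpa using hs⟩

theorem neighborsOf_BCay_one (S X : Set G) :
    (BCay G S).neighborsOf (X ×ˢ {1}) = (S⁻¹ * X) ×ˢ {0} := by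
  ext ⟨h, j⟩
  simp only [SimpleGraph.neighborsOf, BCay, SimpleGraph.fromRel_adj, Set.mem_ofPred_eq,
    Set.mem_prod, Set.mem_singleton_iff, Set.mem_mul]
  constructor
  · rintro ⟨⟨x, i⟩, ⟨hx, rfl⟩, -, ⟨h0, -, -⟩ | ⟨rfl, -, hs⟩⟩
    · simp at h0
    · exact ⟨⟨h * x⁻¹, by simpa using hs, x, hx, by simp⟩, rfl⟩
  · rintro ⟨⟨s, hs, x, hx, rfl⟩, rfl⟩
    exact ⟨(x, 1), ⟨hx, rfl⟩, by simp, by simpa using hs⟩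

theorem ncard_prod_singleton {α β : Type*} (X : Set α) (b : β) : (X ×ˢ {b}).ncard = X.ncard := by
  rw [Set.ncard_prod, Set.ncard_singleton, mul_one]

/-- The numbers of endpoints of walks of length one, two and three that start in a given vertex
are preserved by isomorphisms of bi-Cayley graphs. -/
theorem ncard_eq_of_BCay_iso {S T : Set G} (φ : BCay G S ≃g BCay G T) :
    S.ncard = T.ncard ∧
      ((S⁻¹ * S).ncard = (T⁻¹ * T).ncard ∨ (S⁻¹ * S).ncard = (T * T⁻¹).ncard) ∧
      (S * (S⁻¹ * S)).ncard = (T * (T⁻¹ * T)).ncard := by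
  have h (X : Set (G × Fin 2)) : (φ '' X).ncard = X.ncard :=
    Set.ncard_image_of_injective _ φ.injective
  have h₁ := h ((BCay G S).neighborsOf ({1} ×ˢ {0}))
  have h₂ := h ((BCay G S).neighborsOf ((BCay G S).neighborsOf ({1} ×ˢ {0})))
  have h₃ := h ((BCay G S).neighborsOf
    ((BCay G S).neighborsOf ((BCay G S).neighborsOf ({1} ×ˢ {0}))))
  obtain ⟨g, i, hg⟩ : ∃ g i, φ '' ({1} ×ˢ {0}) = {g} ×ˢ {i} :=
    ⟨(φ (1, 0)).1, (φ (1, 0)).2, by simp⟩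
  simp only [φ.image_neighborsOf, hg] at h₁ h₂ h₃
  obtain rfl | rfl : i = 0 ∨ i = 1 := by omega
  · simp only [neighborsOf_BCay_zero, neighborsOf_BCay_one, ncard_prod_singleton, ← mul_assoc,
      ncard_mul_singleton] at h₁ h₂ h₃
    simp only [← mul_assoc]
    exact ⟨h₁.symm, .inl h₂.symm, h₃.symm⟩
  · simp only [neighborsOf_BCay_zero, neighborsOf_BCay_one, ncard_prod_singleton, ← mul_assoc,
      ncard_mul_singleton] at h₁ h₂ h₃
    rw [ncard_inv_set] at h₁
    rw [← ncard_inv_set] at h₃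
    simp only [mul_inv_rev, inv_inv] at h₃
    simp only [← mul_assoc] at h₃ ⊢
    exact ⟨h₁.symm, .inr h₂.symm, h₃.symm⟩

end Neighbors

section DihedralGroup

/-- The automorphism `r i ↦ r (u i)`, `sr i ↦ sr (u i + v)` of the dihedral group of order ten. -/
def dihedralFiveAut (u w v : ZMod 5) (hu : u * w = 1) : DihedralGroup 5 ≃* DihedralGroup 5 where
  toFun
    | .r i => .r (u * i)
    | .sr i => .sr (u * i + v)
  invFun
    | .r i => .r (w * i)
    | .sr i => .sr (w * (i - v))
  left_inv := by
    rintro (i | i) <;> simp only [DihedralGroup.r.injEq, DihedralGroup.sr.injEq] <;>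
      linear_combination i * hu
  right_inv := by
    rintro (i | i) <;> simp only [DihedralGroup.r.injEq, DihedralGroup.sr.injEq]
    · linear_combination i * hu
    · linear_combination (i - v) * hu
  map_mul' := by
    rintro (i | i) (j | j) <;>
      simp only [DihedralGroup.r_mul_r, DihedralGroup.r_mul_sr, DihedralGroup.sr_mul_r,
        DihedralGroup.sr_mul_sr, DihedralGroup.r.injEq, DihedralGroup.sr.injEq] <;> ring

/-- Representatives of the affine equivalence classes of `k`-subsets, for `k ≤ 4`. -/
def affRep : ℕ → List (List (DihedralGroup 5))
  | 0 => [[]]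
  | 1 => [[.r 0]]
  | 2 => [[.r 0, .r 1], [.r 0, .sr 0]]
  | 3 => [[.r 0, .r 1, .r 2], [.r 0, .r 1, .sr 0]]
  | 4 => [[.r 0, .r 1, .r 2, .r 3], [.r 0, .r 1, .r 2, .sr 0], [.r 0, .r 1, .sr 0, .sr 1],
      [.r 0, .r 1, .sr 0, .sr 2]]
  | _ => []

theorem card_of_mem_affRep : ∀ k < 5, ∀ R ∈ affRep k, R.toFinset.card = k := by
  decide +kernel

set_option synthInstance.maxSize 1000 in
theorem exists_affRep_insert : ∀ k < 4, ∀ R ∈ affRep k, ∀ x ∉ R, ∃ R' ∈ affRep (k + 1),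
    ∃ (u w : ZMod 5) (hu : u * w = 1) (v : ZMod 5), ∃ g ∈ x :: R,
      ∀ s ∈ R', g * dihedralFiveAut u w v hu s ∈ x :: R := by
  decide +kernel

theorem card_inv_mul_affRep : ∀ k < 5, ∀ R ∈ affRep k,
    (R.toFinset⁻¹ * R.toFinset).card = (R.toFinset * R.toFinset⁻¹).card := by
  decide +kernel

theorem affRep_eq_of_card_eq : ∀ k < 5, ∀ R ∈ affRep k, ∀ R' ∈ affRep k,
    (R.toFinset⁻¹ * R.toFinset).card = (R'.toFinset⁻¹ * R'.toFinset).card →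
      (R.toFinset * (R.toFinset⁻¹ * R.toFinset)).card =
        (R'.toFinset * (R'.toFinset⁻¹ * R'.toFinset)).card → R = R' := by
  decide +kernel

theorem exists_affRep (S : Finset (DihedralGroup 5)) (hS : S.card ≤ 4) :
    ∃ R ∈ affRep S.card, AffEquiv (R.toFinset : Set (DihedralGroup 5)) S := by
  induction S using Finset.induction_on with
  | empty => exact ⟨[], by simp [affRep], 1, .refl _, by simp⟩
  | insert x S hx ih =>
    rw [Finset.card_insert_of_notMem hx] at hS ⊢
    obtain ⟨R, hR, g, α, hg⟩ := ih (by omega)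
    obtain ⟨y, rfl⟩ : ∃ y, g * α y = x := ⟨α.symm (g⁻¹ * x), by simp⟩
    have hy : y ∉ R := fun hy => hx (by
      rw [← Finset.mem_coe, hg]
      exact ⟨y, by simpa using hy, rfl⟩)
    obtain ⟨R', hR', u, w, hu, v, k, -, hk⟩ := exists_affRep_insert _ (by omega) R hR y hy
    have hf' : Function.Injective fun s => k * dihedralFiveAut u w v hu s :=
      fun a b h => by simpa using h
    have hRR' : insert y R.toFinset =
        R'.toFinset.image fun s => k * dihedralFiveAut u w v hu s := by
      refine (Finset.eq_of_subset_of_card_le (fun z hz => ?_) ?_).symm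
      · obtain ⟨s, hs, rfl⟩ := Finset.mem_image.1 hz
        simpa using hk s (List.mem_toFinset.1 hs)
      · rw [Finset.card_insert_of_notMem (by simpa using hy), Finset.card_image_of_injective _ hf',
          card_of_mem_affRep _ (by omega) R hR, card_of_mem_affRep _ (by omega) R' hR']
    refine ⟨R', hR', .trans (T := ↑(insert y R.toFinset))
      ⟨k, dihedralFiveAut u w v hu, ?_⟩ ⟨g, α, ?_⟩⟩
    · rw [hRR', Finset.coe_image]
    · rw [Finset.coe_insert, hg, Finset.coe_insert, Set.image_insert_eq]

end DihedralGroup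

/-- `D₁₀` is a 4-BCI-group. -/
theorem D10_four_BCI : IsmBCIGroup (DihedralGroup 5) 4 := by
  rintro S hS T ⟨φ⟩
  lift S to Finset (DihedralGroup 5) using S.toFinite
  lift T to Finset (DihedralGroup 5) using T.toFinite
  obtain ⟨h₁, h₂, h₃⟩ := ncard_eq_of_BCay_iso φ
  rw [Set.ncard_coe_finset] at hS
  have hST : S.card = T.card := by simpa only [Set.ncard_coe_finset] using h₁
  obtain ⟨R, hR, hRS⟩ := exists_affRep S hS
  obtain ⟨R', hR', hRT⟩ := exists_affRep T (hST ▸ hS)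
  rw [← hST] at hR'
  rw [← hRS.ncard_inv_mul, ← hRT.ncard_inv_mul, ← hRT.ncard_mul_inv] at h₂
  rw [← hRS.ncard_mul_inv_mul, ← hRT.ncard_mul_inv_mul] at h₃
  simp only [← Finset.coe_inv, ← Finset.coe_mul, Set.ncard_coe_finset,
    ← card_inv_mul_affRep _ (Nat.lt_succ_of_le hS) R' hR', or_self] at h₂ h₃
  obtain rfl := affRep_eq_of_card_eq _ (Nat.lt_succ_of_le hS) R hR R' hR' h₂ h₃
  exact hRS.symm.trans hRT
end

section
/- Let n ≥ 2. The dihedral group D_{2n} of order 2n is a BCI-group if and only if n ∈ {2, 3, 5}. -/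
open SimpleGraph

namespace BCay

variable {G : Type*} [Group G]

lemma adj_iff {S : Set G} {u v : G × Fin 2} :
    (BCay G S).Adj u v ↔
      (u.2 = 0 ∧ v.2 = 1 ∧ v.1 * u.1⁻¹ ∈ S) ∨ (v.2 = 0 ∧ u.2 = 1 ∧ u.1 * v.1⁻¹ ∈ S) := by
  rw [BCay, SimpleGraph.fromRel_adj]
  constructor
  · exact fun h => h.2
  · refine fun h => ⟨?_, h⟩
    rintro rfl
    rcases h with h | h <;> simp [h.1] at h

/-- Two permutations of `G`, acting on the two parts and respecting the quotient relations of
`S` and `T`, induce an isomorphism of bi-Cayley graphs. -/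
def isoOfPerms {S T : Set G} (φ ψ : Equiv.Perm G)
    (h : ∀ x y, ψ y * (φ x)⁻¹ ∈ T ↔ y * x⁻¹ ∈ S) : BCay G S ≃g BCay G T where
  toEquiv :=
    { toFun := fun u => (if u.2 = 0 then φ u.1 else ψ u.1, u.2)
      invFun := fun u => (if u.2 = 0 then φ.symm u.1 else ψ.symm u.1, u.2)
      left_inv := by rintro ⟨x, i⟩; fin_cases i <;> simp
      right_inv := by rintro ⟨x, i⟩; fin_cases i <;> simp }
  map_rel_iff' := by
    rintro ⟨x, i⟩ ⟨y, j⟩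
    fin_cases i <;> fin_cases j <;> simp [adj_iff, h]

/-- Interchanging the two parts. -/
def isoInv (S : Set G) : BCay G S ≃g BCay G {x | x⁻¹ ∈ S} where
  toEquiv := (Equiv.refl G).prodCongr (Equiv.swap 0 1)
  map_rel_iff' := by
    rintro ⟨x, i⟩ ⟨y, j⟩
    fin_cases i <;> fin_cases j <;> simp [adj_iff]

/-- The equivalence of connection sets which bi-Cayley isomorphism must imply in a BCI-group. -/
def SetEquiv (S T : Set G) : Prop :=
  ∃ (g : G) (α : G ≃* G), T = (fun s => g * α s) '' S

lemma SetEquiv.symm {S T : Set G} (h : SetEquiv S T) : SetEquiv T S := by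
  obtain ⟨g, α, rfl⟩ := h
  refine ⟨α.symm g⁻¹, α.symm, ?_⟩
  rw [Set.image_image]
  simp

lemma SetEquiv.trans {S T U : Set G} (h : SetEquiv S T) (h' : SetEquiv T U) : SetEquiv S U := by
  obtain ⟨g, α, rfl⟩ := h
  obtain ⟨k, β, rfl⟩ := h'
  refine ⟨k * β g, α.trans β, ?_⟩
  rw [Set.image_image]
  simp [mul_assoc]

lemma SetEquiv.nonempty_iso {S T : Set G} (h : SetEquiv S T) :
    Nonempty (BCay G S ≃g BCay G T) := by
  obtain ⟨g, α, rfl⟩ := h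
  refine ⟨isoOfPerms α.toEquiv (α.toEquiv.trans (Equiv.mulLeft g)) fun x y => ?_⟩
  simp [mul_assoc, ← map_inv, ← map_mul]

section Invariant

open scoped Classical in
/-- The number of walks of length three from `u` to `v`. -/
noncomputable def threeWalks {V : Type*} [Fintype V] (Γ : SimpleGraph V) (u v : V) : ℕ :=
  ∑ p, ∑ q, if Γ.Adj u p ∧ Γ.Adj p q ∧ Γ.Adj q v then 1 else 0

lemma threeWalks_iso {V W : Type*} [Fintype V] [Fintype W] {Γ : SimpleGraph V}
    {Δ : SimpleGraph W} (e : Γ ≃g Δ) (u v : V) :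
    threeWalks Δ (e u) (e v) = threeWalks Γ u v := by
  unfold threeWalks
  rw [← e.toEquiv.sum_comp]
  refine Finset.sum_congr rfl fun p _ => ?_
  rw [← e.toEquiv.sum_comp]
  refine Finset.sum_congr rfl fun q _ => ?_
  congr 1
  simp only [RelIso.coe_fn_toEquiv, e.map_adj_iff]

lemma sum_threeWalks_sq_iso {V W : Type*} [Fintype V] [Fintype W] {Γ : SimpleGraph V}
    {Δ : SimpleGraph W} (e : Γ ≃g Δ) :
    ∑ u, ∑ v, threeWalks Γ u v ^ 2 = ∑ u, ∑ v, threeWalks Δ u v ^ 2 := by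
  rw [← e.toEquiv.sum_comp]
  refine Finset.sum_congr rfl fun u _ => ?_
  rw [← e.toEquiv.sum_comp]
  exact Finset.sum_congr rfl fun v _ => by rw [← threeWalks_iso e u v]; rfl

variable [Fintype G]

/-- The number of ways of writing `z` as `s * t⁻¹ * w` with `s`, `t`, `w` in `S`. -/
def tripleCount (S : Set G) [DecidablePred (· ∈ S)] (z : G) : ℕ :=
  ∑ x, ∑ y, if x ∈ S ∧ x * y⁻¹ ∈ S ∧ z * y⁻¹ ∈ S then 1 else 0

/-- Up to the factor `2 * card G`, the number of closed walks of length six in `BCay G S`. -/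
def tripleEnergy (S : Set G) [DecidablePred (· ∈ S)] : ℕ :=
  ∑ z, tripleCount S z ^ 2

lemma threeWalks_zero_one (S : Set G) [DecidablePred (· ∈ S)] (g h : G) :
    threeWalks (BCay G S) (g, 0) (h, 1) = tripleCount S (h * g⁻¹) := by
  simp only [threeWalks, tripleCount, adj_iff, Fintype.sum_prod_type, Fin.sum_univ_two]
  rw [← Equiv.sum_comp (Equiv.mulRight g)]
  refine Finset.sum_congr rfl fun x _ => ?_
  simp only [Equiv.coe_mulRight, one_ne_zero, zero_ne_one, true_and, false_and, and_false,
    or_false, false_or, if_false, Finset.sum_const_zero, zero_add, add_zero]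
  rw [← Equiv.sum_comp (Equiv.mulRight g)]
  simp [mul_assoc]

lemma threeWalks_one_zero (S : Set G) [DecidablePred (· ∈ S)] (g h : G) :
    threeWalks (BCay G S) (h, 1) (g, 0) = tripleCount S (h * g⁻¹) := by
  rw [← threeWalks_zero_one]
  unfold threeWalks
  rw [Finset.sum_comm]
  refine Finset.sum_congr rfl fun q _ => Finset.sum_congr rfl fun p _ => ?_
  congr 1
  simp only [SimpleGraph.adj_comm _ (h, (1 : Fin 2)) p, SimpleGraph.adj_comm _ p q,
    SimpleGraph.adj_comm _ q (g, (0 : Fin 2)), eq_iff_iff]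
  tauto

lemma threeWalks_self_part (S : Set G) (g h : G) (i : Fin 2) :
    threeWalks (BCay G S) (g, i) (h, i) = 0 := by
  unfold threeWalks
  refine Finset.sum_eq_zero fun p _ => Finset.sum_eq_zero fun q _ => if_neg ?_
  simp only [adj_iff]
  grind

lemma sum_threeWalks_sq (S : Set G) [DecidablePred (· ∈ S)] :
    ∑ u, ∑ v, threeWalks (BCay G S) u v ^ 2 = 2 * Fintype.card G * tripleEnergy S := by
  have h₁ (g : G) : ∑ h, tripleCount S (h * g⁻¹) ^ 2 = tripleEnergy S :=
    Equiv.sum_comp (Equiv.mulRight g⁻¹) fun z => tripleCount S z ^ 2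
  have h₂ (h : G) : ∑ g, tripleCount S (h * g⁻¹) ^ 2 = tripleEnergy S :=
    Equiv.sum_comp ((Equiv.inv G).trans (Equiv.mulLeft h)) fun z => tripleCount S z ^ 2
  simp only [Fintype.sum_prod_type, Fin.sum_univ_two, threeWalks_self_part, threeWalks_zero_one,
    threeWalks_one_zero]
  simp [h₁, h₂]
  ring

lemma tripleEnergy_eq_of_iso {S T : Set G} [DecidablePred (· ∈ S)] [DecidablePred (· ∈ T)]
    (e : BCay G S ≃g BCay G T) : tripleEnergy S = tripleEnergy T := by
  have h := sum_threeWalks_sq_iso e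
  rw [sum_threeWalks_sq, sum_threeWalks_sq] at h
  exact Nat.eq_of_mul_eq_mul_left (by have := Fintype.card_pos (α := G); positivity) h

/-- A group is BCI as soon as `tripleEnergy` separates a family of representatives of all
connection sets. -/
lemma isBCIGroup_of_representatives {ι : Type*} (c : ι → Set G)
    [∀ i, DecidablePred (· ∈ c i)] (C : List ι)
    (hinj : (C.map fun i => tripleEnergy (c i)).Nodup)
    (hC : ∀ S : Set G, ∃ i ∈ C, SetEquiv S (c i)) : IsBCIGroup G := by
  intro S T ⟨e⟩
  obtain ⟨i, hi, hS⟩ := hC S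
  obtain ⟨j, hj, hT⟩ := hC T
  obtain ⟨e₁⟩ := hS.symm.nonempty_iso
  obtain ⟨e₂⟩ := hT.nonempty_iso
  obtain rfl := List.inj_on_of_nodup_map hinj hi hj
    (tripleEnergy_eq_of_iso ((e₁.trans e).trans e₂))
  exact hS.trans hT.symm

end Invariant

section Dihedral

open DihedralGroup

variable {n : ℕ}

/-- The subset of `DihedralGroup n` with rotations indexed by `X` and reflections by `Y`. -/
def dihedralSet (X Y : Finset (ZMod n)) : Set (DihedralGroup n) :=
  {g | match g with
    | r i => i ∈ X
    | sr i => i ∈ Y}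

@[simp] lemma r_mem_dihedralSet {X Y : Finset (ZMod n)} {i : ZMod n} :
    r i ∈ dihedralSet X Y ↔ i ∈ X := Iff.rfl

@[simp] lemma sr_mem_dihedralSet {X Y : Finset (ZMod n)} {i : ZMod n} :
    sr i ∈ dihedralSet X Y ↔ i ∈ Y := Iff.rfl

instance (X Y : Finset (ZMod n)) : DecidablePred (· ∈ dihedralSet X Y)
  | r i => inferInstanceAs (Decidable (i ∈ X))
  | sr i => inferInstanceAs (Decidable (i ∈ Y))

/-- The automorphism `r i ↦ r (k * i)`, `sr i ↦ sr (k * i + w)`. -/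
def affineAut (k : (ZMod n)ˣ) (w : ZMod n) : DihedralGroup n ≃* DihedralGroup n where
  toFun
    | r i => r (k * i)
    | sr i => sr (k * i + w)
  invFun
    | r i => r (k⁻¹ * i)
    | sr i => sr (k⁻¹ * (i - w))
  left_inv := by rintro (i | i) <;> simp
  right_inv := by rintro (i | i) <;> simp
  map_mul' := by rintro (i | i) (j | j) <;> simp <;> ring

lemma image_eq_dihedralSet (X Y X' Y' : Finset (ZMod n)) (φ : DihedralGroup n → DihedralGroup n)
    (h : ∀ g, φ g ∈ dihedralSet X' Y' ↔ g ∈ dihedralSet X Y) (hφ : φ.Surjective) :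
    dihedralSet X' Y' = φ '' dihedralSet X Y := by
  rw [← Set.image_preimage_eq (dihedralSet X' Y') hφ]
  congr 1
  ext g
  exact h g

lemma dihedralSet_swap (X Y : Finset (ZMod n)) :
    SetEquiv (dihedralSet X Y) (dihedralSet Y X) := by
  refine ⟨sr 0, MulEquiv.refl _, image_eq_dihedralSet _ _ _ _ _ ?_ ?_⟩
  · rintro (i | i) <;> simp
  · exact (Equiv.mulLeft (sr (0 : ZMod n))).surjective

lemma dihedralSet_affine (X Y : Finset (ZMod n)) (k : (ZMod n)ˣ) (u v : ZMod n) :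
    SetEquiv (dihedralSet X Y)
      (dihedralSet (X.image fun i => k * i + u) (Y.image fun i => k * i + v)) := by
  refine ⟨r u, affineAut k (u + v), image_eq_dihedralSet _ _ _ _ _ ?_ ?_⟩
  · rintro (i | i) <;> simp [affineAut]
    · simp [add_comm]
    · simp [← add_assoc, add_sub_right_comm]
  · exact ((affineAut k (u + v)).toEquiv.trans (Equiv.mulLeft (r u))).surjective

lemma exists_eq_dihedralSet [NeZero n] (S : Set (DihedralGroup n)) :
    ∃ X Y, S = dihedralSet X Y := by
  classical
  refine ⟨Finset.univ.filter fun i => r i ∈ S, Finset.univ.filter fun i => sr i ∈ S, ?_⟩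
  ext (i | i) <;> simp

/-- Normal forms of connection sets: translate the rotation and reflection parts separately to
representatives in `R`, then rescale, translate and possibly interchange them. -/
lemma exists_setEquiv_of_normalForm {p : ℕ} (hp : p.Prime) (R : List (Finset (ZMod p)))
    (C : List (Finset (ZMod p) × Finset (ZMod p)))
    (hR : ∀ X : Finset (ZMod p), ∃ u, X.image (fun i => i + u) ∈ R)
    (hC : ∀ X ∈ R, ∀ Y ∈ R, ∃ k : ZMod p, k ≠ 0 ∧ ∃ u v,
      (X.image (fun i => k * i + u), Y.image (fun i => k * i + v)) ∈ C ∨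
      (Y.image (fun i => k * i + v), X.image (fun i => k * i + u)) ∈ C)
    (S : Set (DihedralGroup p)) : ∃ q ∈ C, SetEquiv S (dihedralSet q.1 q.2) := by
  have : Fact p.Prime := ⟨hp⟩
  obtain ⟨X, Y, rfl⟩ := exists_eq_dihedralSet S
  obtain ⟨u, hu⟩ := hR X
  obtain ⟨v, hv⟩ := hR Y
  have h₁ := dihedralSet_affine X Y 1 u v
  simp only [Units.val_one, one_mul] at h₁
  obtain ⟨k, hk, u', v', h⟩ := hC _ hu _ hv
  have h₂ := h₁.trans (dihedralSet_affine _ _ (Units.mk0 k hk) u' v')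
  rcases h with h | h
  · exact ⟨_, h, h₂⟩
  · exact ⟨_, h, h₂.trans (dihedralSet_swap _ _)⟩

lemma isBCIGroup_dihedralGroup_five : IsBCIGroup (DihedralGroup 5) := by
  let R : List (Finset (ZMod 5)) :=
    [∅, {0}, {0, 1}, {0, 2}, {0, 1, 2}, {0, 1, 3}, {0, 1, 2, 3}, {0, 1, 2, 3, 4}]
  let C : List (Finset (ZMod 5) × Finset (ZMod 5)) :=
    [(∅, ∅), (∅, {0}), (∅, {0, 1}), (∅, {0, 1, 2}), (∅, {0, 1, 2, 3}), (∅, {0, 1, 2, 3, 4}),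
      ({0}, {0}), ({0}, {0, 1}), ({0}, {0, 1, 2}), ({0}, {0, 1, 2, 3}), ({0}, {0, 1, 2, 3, 4}),
      ({0, 1}, {0, 1}), ({0, 1}, {0, 2}), ({0, 1}, {0, 1, 2}), ({0, 1}, {0, 1, 3}),
      ({0, 1}, {0, 1, 2, 3}), ({0, 1}, {0, 1, 2, 3, 4}),
      ({0, 1, 2}, {0, 1, 2}), ({0, 1, 2}, {0, 1, 3}), ({0, 1, 2}, {0, 1, 2, 3}),
      ({0, 1, 2}, {0, 1, 2, 3, 4}), ({0, 1, 2, 3}, {0, 1, 2, 3}),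
      ({0, 1, 2, 3}, {0, 1, 2, 3, 4}), ({0, 1, 2, 3, 4}, {0, 1, 2, 3, 4})]
  refine isBCIGroup_of_representatives (fun q : Finset (ZMod 5) × Finset (ZMod 5) =>
    dihedralSet q.1 q.2) C ?_ (exists_setEquiv_of_normalForm (by norm_num) R C ?_ ?_)
  · have : (C.map fun q => tripleEnergy (dihedralSet q.1 q.2)) =
        [0, 1, 20, 153, 820, 3125, 32, 141, 484, 1661, 5076, 640, 460, 1793, 1613, 4740, 11845,
          4896, 4716, 11833, 26228, 26240, 53145, 100000] := by
      decide +kernel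
    rw [this]
    decide
  · decide +kernel
  · decide +kernel

lemma isBCIGroup_dihedralGroup_three : IsBCIGroup (DihedralGroup 3) := by
  let R : List (Finset (ZMod 3)) := [∅, {0}, {0, 1}, {0, 1, 2}]
  let C : List (Finset (ZMod 3) × Finset (ZMod 3)) :=
    [(∅, ∅), (∅, {0}), (∅, {0, 1}), (∅, {0, 1, 2}), ({0}, {0}), ({0}, {0, 1}), ({0}, {0, 1, 2}),
      ({0, 1}, {0, 1}), ({0, 1}, {0, 1, 2}), ({0, 1, 2}, {0, 1, 2})]
  refine isBCIGroup_of_representatives (fun q : Finset (ZMod 3) × Finset (ZMod 3) =>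
    dihedralSet q.1 q.2) C ?_ (exists_setEquiv_of_normalForm (by norm_num) R C ?_ ?_) <;>
  decide +kernel

lemma isBCIGroup_dihedralGroup_two : IsBCIGroup (DihedralGroup 2) := by
  let R : List (Finset (ZMod 2)) := [∅, {0}, {0, 1}]
  let C : List (Finset (ZMod 2) × Finset (ZMod 2)) :=
    [(∅, ∅), (∅, {0}), ({0}, {0}), ({0}, {0, 1}), ({0, 1}, {0, 1})]
  refine isBCIGroup_of_representatives (fun q : Finset (ZMod 2) × Finset (ZMod 2) =>
    dihedralSet q.1 q.2) C (by decide +kernel) fun S => ?_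
  obtain ⟨q, hq, h⟩ := exists_setEquiv_of_normalForm (by norm_num) R ((∅, {0, 1}) :: C)
    (by decide +kernel) (by decide +kernel) S
  rcases List.mem_cons.1 hq with rfl | hq
  · -- The automorphism group of the Klein four-group merges two of the normal forms.
    let φ : DihedralGroup 2 → DihedralGroup 2
      | r i => if i = 0 then r 0 else sr 0
      | sr i => if i = 0 then r 1 else sr 1
    have hφ : Function.Involutive φ := by change ∀ g, φ (φ g) = g; decide +kernel
    let α : DihedralGroup 2 ≃* DihedralGroup 2 :=
      { hφ.toPerm with map_mul' := by change ∀ x y, φ (x * y) = φ x * φ y; decide +kernel }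
    refine ⟨({0}, {0}), by decide +kernel, h.trans ((dihedralSet_swap _ _).trans ⟨1, α, ?_⟩)⟩
    refine image_eq_dihedralSet _ _ _ _ _ ?_ ((α.toEquiv.trans (Equiv.mulLeft 1)).surjective)
    change ∀ g, 1 * φ g ∈ dihedralSet _ _ ↔ _
    decide +kernel
  · exact ⟨q, hq, h⟩

lemma not_isBCIGroup_dihedralGroup_four : ¬ IsBCIGroup (DihedralGroup 4) := by
  intro h
  let φ : DihedralGroup 4 → DihedralGroup 4
    | r i => if i.val < 2 then r i else sr (i - 2)
    | sr i => if i.val < 2 then r (i + 2) else sr i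
  have hφ : Function.Involutive φ := by change ∀ g, φ (φ g) = g; decide +kernel
  have hadj : ∀ x y, φ y * (φ x)⁻¹ ∈ dihedralSet {0} {0} ↔ y * x⁻¹ ∈ dihedralSet {0, 2} ∅ := by
    decide +kernel
  obtain ⟨g, α, hT⟩ := h (dihedralSet {0, 2} ∅) (dihedralSet {0} {0})
    ⟨isoOfPerms hφ.toPerm hφ.toPerm hadj⟩
  have h₁ : r 0 ∈ dihedralSet (n := 4) {0} {0} := by rw [r_mem_dihedralSet]; simp
  have h₂ : sr 0 ∈ dihedralSet (n := 4) {0} {0} := by simp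
  rw [hT] at h₁ h₂
  obtain ⟨x, hx, hx'⟩ := h₁
  obtain ⟨y, hy, hy'⟩ := h₂
  have hdiff : α (x⁻¹ * y) = sr 0 := by
    have : (g * α x)⁻¹ * (g * α y) = sr 0 := by simp only [hx', hy']; simp
    simpa [mul_assoc] using this
  have hcomm : ∀ x ∈ dihedralSet (n := 4) {0, 2} ∅, ∀ y ∈ dihedralSet (n := 4) {0, 2} ∅,
      ∀ z, x⁻¹ * y * z = z * (x⁻¹ * y) := by decide +kernel
  have := congrArg α (hcomm x hx y hy (α.symm (r 1)))
  simp only [map_mul α (x⁻¹ * y), map_mul α _ (x⁻¹ * y), hdiff, α.apply_symm_apply] at this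
  revert this
  decide +kernel

lemma exists_affine_of_mulEquiv (hn : 3 ≤ n) (α : DihedralGroup n ≃* DihedralGroup n) :
    ∃ k w : ZMod n, ∀ i, α (r i) = r (k * i) ∧ α (sr i) = sr (k * i + w) := by
  have : NeZero n := ⟨by omega⟩
  have h2 : (2 : ZMod n) ≠ 0 := by
    intro h
    have := Nat.le_of_dvd (by norm_num) ((ZMod.natCast_eq_zero_iff 2 n).1 (by exact_mod_cast h))
    omega
  obtain ⟨k, hk⟩ : ∃ k, α (r 1) = r k := by
    rcases h : α (r 1) with k | k
    · exact ⟨k, rfl⟩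
    · have h' : α (r 1 * r 1) = 1 := by rw [map_mul, h, sr_mul_self]
      rw [EmbeddingLike.map_eq_one_iff, r_mul_r, one_def, r.injEq, one_add_one_eq_two] at h'
      exact absurd h' h2
  have hr (i : ZMod n) : α (r i) = r (k * i) := by
    rw [← ZMod.natCast_zmod_val i, ← r_one_pow, map_pow, hk, r_pow]
  obtain ⟨w, hw⟩ : ∃ w, α (sr 0) = sr w := by
    rcases h : α (sr 0) with m | w
    · have h' : α (sr 0 * r 1) = α (r 1 * sr 0) := by
        rw [map_mul, map_mul, h, hk, r_mul_r, r_mul_r, add_comm]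
      have h'' := α.injective h'
      simp only [sr_mul_r, r_mul_sr, sr.injEq, zero_add, zero_sub] at h''
      exact absurd (by linear_combination h'') h2
    · exact ⟨w, rfl⟩
  refine ⟨k, w, fun i => ⟨hr i, ?_⟩⟩
  have : sr i = sr 0 * r i := by simp
  rw [this, map_mul, hw, hr, sr_mul_r, add_comm]

lemma not_isBCIGroup_dihedralGroup (hn : 6 ≤ n) : ¬ IsBCIGroup (DihedralGroup n) := by
  intro h
  have hne (m : ℕ) (hm : 0 < m) (hm' : m < 6) : (m : ZMod n) ≠ 0 := fun h => by
    have := Nat.le_of_dvd hm ((ZMod.natCast_eq_zero_iff m n).1 h)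
    omega
  have h1 := hne 1 (by norm_num) (by norm_num)
  have h2 := hne 2 (by norm_num) (by norm_num)
  have h3 := hne 3 (by norm_num) (by norm_num)
  have h4 := hne 4 (by norm_num) (by norm_num)
  have h5 := hne 5 (by norm_num) (by norm_num)
  push_cast at h1 h2 h3 h4 h5
  let X : Finset (ZMod n) := {0, 1, 3}
  obtain ⟨g, α, hT⟩ := h (dihedralSet X X) _ ⟨isoInv _⟩
  obtain ⟨k, w, hα⟩ := exists_affine_of_mulEquiv (by omega) α
  obtain ⟨c, hc⟩ : ∃ c, ∀ i ∈ X, -(i + c) ∈ X := by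
    rcases g with u | u
    · refine ⟨2 * u - w, fun i hi => ?_⟩
      have h₁ : sr i ∈ {x | x⁻¹ ∈ dihedralSet X X} := by simpa using hi
      rw [hT] at h₁
      obtain ⟨x | x, hx, hx'⟩ := h₁
      · simp [hα] at hx'
      · have h₂ : r (u + k * x) ∈ {x | x⁻¹ ∈ dihedralSet X X} := by
          rw [hT]; exact ⟨r x, hx, by simp [hα]⟩
        simp only [hα, r_mul_sr, sr.injEq] at hx'
        have : -(i + (2 * u - w)) = -(u + k * x) := by linear_combination hx'
        rw [this]
        simpa using h₂
    · refine ⟨w - 2 * u, fun i hi => ?_⟩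
      have h₁ : sr i ∈ {x | x⁻¹ ∈ dihedralSet X X} := by simpa using hi
      rw [hT] at h₁
      obtain ⟨x | x, hx, hx'⟩ := h₁
      · have h₂ : r (k * x + w - u) ∈ {x | x⁻¹ ∈ dihedralSet X X} := by
          rw [hT]; exact ⟨sr x, hx, by simp [hα]⟩
        simp only [hα, sr_mul_r, sr.injEq] at hx'
        have : -(i + (w - 2 * u)) = -(k * x + w - u) := by linear_combination hx'
        rw [this]
        simpa using h₂
      · simp [hα] at hx'
  have c0 := hc 0 (by simp [X])
  have c1 := hc 1 (by simp [X])
  have c3 := hc 3 (by simp [X])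
  simp only [X, Finset.mem_insert, Finset.mem_singleton] at c0 c1 c3
  grind

end Dihedral

end BCay

/-- For `n ≥ 2`, `D_{2n}` is a BCI-group iff `n ∈ {2, 3, 5}`. -/
theorem dihedral_BCIGroup_iff (n : ℕ) (hn : 2 ≤ n) :
    IsBCIGroup (DihedralGroup n) ↔ n = 2 ∨ n = 3 ∨ n = 5 := by
  constructor
  · intro h
    by_contra hne
    rcases (by omega : n = 4 ∨ 6 ≤ n) with rfl | h6
    · exact BCay.not_isBCIGroup_dihedralGroup_four h
    · exact BCay.not_isBCIGroup_dihedralGroup h6 h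
  · rintro (rfl | rfl | rfl)
    · exact BCay.isBCIGroup_dihedralGroup_two
    · exact BCay.isBCIGroup_dihedralGroup_three
    · exact BCay.isBCIGroup_dihedralGroup_five
end
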